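/- Let P be a finite partial IP loop and x ∈ P. Then the sets L = {a ∈ P : (a,x) ∈ Γ(P)} and R = {a ∈ P : (x,a) ∈ Γ(P)} have the same number of elements. -/

import Mathlib

/-- A partial IP loop: a set `carrier` with a partial binary operation defined on
a domain `dom ⊆ carrier ×ˢ carrier` (the value of `mul` is only meaningful on `dom`),
with a unit, unique two-sided inverses, and the inverse property. -/
structure PartialIPLoop (α : Type*) where
  carrier : Set α
  one : α
  dom : Set (α × α)
  mul : α → α → α
  inv : α → α
  one_mem : one ∈ carrier
  dom_subset : dom ⊆ carrier ×ˢ carrier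
  mul_mem : ∀ x y, (x, y) ∈ dom → mul x y ∈ carrier
  one_mul_dom : ∀ x ∈ carrier, (one, x) ∈ dom
  mul_one_dom : ∀ x ∈ carrier, (x, one) ∈ dom
  one_mul : ∀ x ∈ carrier, mul one x = x
  mul_one : ∀ x ∈ carrier, mul x one = x
  inv_mem : ∀ x ∈ carrier, inv x ∈ carrier
  mul_inv_dom : ∀ x ∈ carrier, (x, inv x) ∈ dom
  inv_mul_dom : ∀ x ∈ carrier, (inv x, x) ∈ dom
  mul_inv : ∀ x ∈ carrier, mul x (inv x) = one
  inv_mul : ∀ x ∈ carrier, mul (inv x) x = one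
  inv_unique : ∀ x ∈ carrier, ∀ y ∈ carrier,
    (x, y) ∈ dom → (y, x) ∈ dom → mul x y = one → mul y x = one → y = inv x
  ip_left_dom : ∀ x y, (x, y) ∈ dom → (inv x, mul x y) ∈ dom
  ip_right_dom : ∀ x y, (x, y) ∈ dom → (mul x y, inv y) ∈ dom
  ip_left : ∀ x y, (x, y) ∈ dom → mul (inv x) (mul x y) = y
  ip_right : ∀ x y, (x, y) ∈ dom → mul (mul x y) (inv y) = x

namespace PartialIPLoop

variable {α : Type*}

/-- The set of gaps `Γ(P) = (P × P) \ D(P)`. -/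
def gaps (P : PartialIPLoop α) : Set (α × α) :=
  (P.carrier ×ˢ P.carrier) \ P.dom

/-- The set `O₂(P)` of elements of order two. -/
def O2 (P : PartialIPLoop α) : Set α :=
  {x ∈ P.carrier | x ≠ P.one ∧ (x, x) ∈ P.dom ∧ P.mul x x = P.one}

/-- The set `O₃(P)` of elements of order three. -/
def O3 (P : PartialIPLoop α) : Set α :=
  {x ∈ P.carrier | x ≠ P.one ∧ (x, x) ∈ P.dom ∧ (x, P.mul x x) ∈ P.dom ∧
    P.mul x (P.mul x x) = P.one}

/-- `Q` is an extension of `P`: `P ⊆ Q`, `D(P) ⊆ D(Q)`, and the operations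
agree on `D(P)`. -/
def Ext (P Q : PartialIPLoop α) : Prop :=
  P.carrier ⊆ Q.carrier ∧ P.dom ⊆ Q.dom ∧
    ∀ x y, (x, y) ∈ P.dom → P.mul x y = Q.mul x y

end PartialIPLoop

namespace PartialIPLoop

variable {α : Type*} (P : PartialIPLoop α)

lemma inv_inv {x : α} (hx : x ∈ P.carrier) : P.inv (P.inv x) = x :=
  (P.inv_unique _ (P.inv_mem x hx) x hx (P.inv_mul_dom x hx) (P.mul_inv_dom x hx)
    (P.inv_mul x hx) (P.mul_inv x hx)).symm

lemma inv_injOn : Set.InjOn P.inv P.carrier := fun x hx y hy h => by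
  rw [← P.inv_inv hx, h, P.inv_inv hy]

lemma inv_inv_mem_dom {x y : α} (h : (x, y) ∈ P.dom) : (P.inv y, P.inv x) ∈ P.dom := by
  have h₁ := P.ip_right_dom _ _ h
  have h₂ := P.ip_left_dom _ _ h₁
  have h₃ := P.ip_right_dom _ _ h₂
  rwa [P.ip_left _ _ h₁, P.ip_right _ _ h] at h₃

lemma mul_right_cancel {a b x : α} (ha : (a, x) ∈ P.dom) (hb : (b, x) ∈ P.dom)
    (h : P.mul a x = P.mul b x) : a = b := by
  rw [← P.ip_right a x ha, h, P.ip_right b x hb]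

lemma mul_left_cancel {a b x : α} (ha : (x, a) ∈ P.dom) (hb : (x, b) ∈ P.dom)
    (h : P.mul x a = P.mul x b) : a = b := by
  rw [← P.ip_left x a ha, h, P.ip_left x b hb]

lemma left_dom_subset (x : α) : {a | (a, x) ∈ P.dom} ⊆ P.carrier :=
  fun _ h => (P.dom_subset h).1

lemma right_dom_subset (x : α) : {a | (x, a) ∈ P.dom} ⊆ P.carrier :=
  fun _ h => (P.dom_subset h).2

lemma ncard_left_dom_eq_ncard_right_dom (hP : P.carrier.Finite) {x : α} (hx : x ∈ P.carrier) :
    {a | (a, x) ∈ P.dom}.ncard = {a | (x, a) ∈ P.dom}.ncard := by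
  apply le_antisymm
  · refine Set.ncard_le_ncard_of_injOn (fun a => P.inv (P.mul a x)) (fun a ha => ?_)
      (fun a ha b hb h => ?_) (hP.subset (P.right_dom_subset x))
    · simpa only [P.inv_inv hx, Set.mem_ofPred_eq] using P.inv_inv_mem_dom (P.ip_right_dom a x ha)
    · exact P.mul_right_cancel ha hb (P.inv_injOn (P.mul_mem _ _ ha) (P.mul_mem _ _ hb) h)
  · refine Set.ncard_le_ncard_of_injOn (fun a => P.inv (P.mul x a)) (fun a ha => ?_)
      (fun a ha b hb h => ?_) (hP.subset (P.left_dom_subset x))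
    · simpa only [P.inv_inv hx, Set.mem_ofPred_eq] using P.inv_inv_mem_dom (P.ip_left_dom x a ha)
    · exact P.mul_left_cancel ha hb (P.inv_injOn (P.mul_mem _ _ ha) (P.mul_mem _ _ hb) h)

lemma left_gaps_eq_diff {x : α} (hx : x ∈ P.carrier) :
    {a | (a, x) ∈ P.gaps} = P.carrier \ {a | (a, x) ∈ P.dom} := by
  ext a
  simp [gaps, hx]

lemma right_gaps_eq_diff {x : α} (hx : x ∈ P.carrier) :
    {a | (x, a) ∈ P.gaps} = P.carrier \ {a | (x, a) ∈ P.dom} := by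
  ext a
  simp [gaps, hx]

end PartialIPLoop

/-- Claim 1: in a finite partial IP loop the sets `L = {a : (a,x) ∈ Γ(P)}` and
`R = {a : (x,a) ∈ Γ(P)}` have the same number of elements. -/
theorem card_left_gaps_eq_card_right_gaps {α : Type*} (P : PartialIPLoop α)
    (hP : P.carrier.Finite) (x : α) (hx : x ∈ P.carrier) :
    {a : α | (a, x) ∈ P.gaps}.ncard = {a : α | (x, a) ∈ P.gaps}.ncard := by
  rw [P.left_gaps_eq_diff hx, P.right_gaps_eq_diff hx,
    Set.ncard_sdiff (P.left_dom_subset x) (hP.subset (P.left_dom_subset x)),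
    Set.ncard_sdiff (P.right_dom_subset x) (hP.subset (P.right_dom_subset x)),
    P.ncard_left_dom_eq_ncard_right_dom hP hx]
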